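/- Let P and Q be two probability measures on a countable set A. Then Σ_{a ∈ A} P({a}) · log( P({a}) / Q({a}) ) ≤ Σ_{a ∈ A} ( P({a}) − Q({a}) )² / Q({a}), where on the left-hand side terms with P({a}) = Q({a}) = 0 are read as 0 (convention log 0/0 = 0), and on the right-hand side 0/0 = 0. -/

import Mathlib

open MeasureTheory
open scoped Classical

/-- The term `P(a) log(P(a)/Q(a))` of the Kullback–Leibler divergence, as an extended real,
with the conventions that it is `0` when `P(a) = 0` (in particular `log 0/0 = 0`) and `+∞`
when `Q(a) = 0 < P(a)`. -/
noncomputable def klTerm (pa qa : ENNReal) : EReal :=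
  if pa = 0 then 0
  else if qa = 0 then ⊤
  else ((pa.toReal * Real.log (pa.toReal / qa.toReal) : ℝ) : EReal)

/-- The term `(P(a) − Q(a))²/Q(a)` of the chi-square divergence, as an extended real, with
the conventions `0/0 = 0` and `u²/0 = +∞` for `u ≠ 0`. -/
noncomputable def chiSqTerm (pa qa : ENNReal) : EReal :=
  if qa = 0 then (if pa = 0 then 0 else ⊤)
  else (((pa.toReal - qa.toReal) ^ 2 / qa.toReal : ℝ) : EReal)

theorem EReal.hasSum_coe {A : Type*} {f : A → ℝ} {s : ℝ} (hf : HasSum f s) :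
    HasSum (fun a => (f a : EReal)) (s : EReal) :=
  hf.map (⟨⟨Real.toEReal, EReal.coe_zero⟩, EReal.coe_add⟩ : ℝ →+ EReal)
    continuous_coe_real_ereal

theorem EReal.tsum_coe_ennreal {A : Type*} (f : A → ENNReal) :
    ∑' a, (f a : EReal) = ((∑' a, f a : ENNReal) : EReal) :=
  (ENNReal.summable.hasSum.map
    (⟨⟨ENNReal.toEReal, EReal.coe_ennreal_zero⟩, EReal.coe_ennreal_add⟩ : ENNReal →+ EReal)
    continuous_coe_ennreal_ereal).tsum_eq

theorem hasSum_measure_singleton_toReal {A : Type*} [MeasurableSpace A]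
    [MeasurableSingletonClass A] [Countable A] (P : Measure A) [IsProbabilityMeasure P] :
    HasSum (fun a => (P {a}).toReal) 1 := by
  have h : ∑' a, P {a} = 1 := by
    simpa using P.tsum_indicator_apply_singleton Set.univ MeasurableSet.univ
  have h_sum := ENNReal.hasSum_toReal (f := fun a => P {a}) (by simp [h])
  rwa [← ENNReal.tsum_toReal_eq (fun a => measure_ne_top P {a}), h, ENNReal.toReal_one] at h_sum

theorem sub_le_mul_log_div {p q : ℝ} (hp : 0 ≤ p) (hq : 0 ≤ q) (hpq : q = 0 → p = 0) :
    p - q ≤ p * Real.log (p / q) := by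
  rcases hp.eq_or_lt with rfl | hp
  · simpa using hq
  have hq : 0 < q := hq.lt_of_ne' fun h => hp.ne' (hpq h)
  calc p - q = p * (1 - (p / q)⁻¹) := by field_simp
    _ ≤ p * Real.log (p / q) := by
      gcongr
      exact Real.one_sub_inv_le_log_of_pos (by positivity)

theorem mul_log_div_le_sq_div_add {p q : ℝ} (hp : 0 ≤ p) (hq : 0 ≤ q) (hpq : q = 0 → p = 0) :
    p * Real.log (p / q) ≤ (p - q) ^ 2 / q + (p - q) := by
  rcases hq.eq_or_lt with rfl | hq
  · simp [hpq rfl]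
  rcases hp.eq_or_lt with rfl | hp
  · simp [sq, hq.ne']
  calc p * Real.log (p / q) ≤ p * (p / q - 1) := by
        gcongr
        exact Real.log_le_sub_one_of_pos (by positivity)
    _ = (p - q) ^ 2 / q + (p - q) := by
      field_simp
      ring

theorem klTerm_eq_coe {p q : ENNReal} (hpq : q = 0 → p = 0) :
    klTerm p q = ((p.toReal * Real.log (p.toReal / q.toReal) : ℝ) : EReal) := by
  unfold klTerm
  split_ifs with hp hq
  · simp [hp]
  · exact absurd (hpq hq) hp
  · rfl

theorem chiSqTerm_eq_coe {p q : ENNReal} (hpq : q = 0 → p = 0) :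
    chiSqTerm p q = (((p.toReal - q.toReal) ^ 2 / q.toReal : ℝ) : EReal) := by
  unfold chiSqTerm
  split_ifs with hq hp
  · simp [hq]
  · exact absurd (hpq hq) hp
  · rfl

theorem chiSqTerm_nonneg (p q : ENNReal) : 0 ≤ chiSqTerm p q := by
  unfold chiSqTerm
  split_ifs
  · rfl
  · exact le_top
  · exact EReal.coe_nonneg.2 (by positivity)

theorem eq_zero_of_chiSqTerm_ne_top {p q : ENNReal} (h : chiSqTerm p q ≠ ⊤) (hq : q = 0) :
    p = 0 := by
  by_contra hp
  simp [chiSqTerm, hp, hq] at h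

/-- Lemma `lemma:KLchi`: for probability measures `P, Q` on a countable
set `A`, `Σ_a P({a}) log(P({a})/Q({a})) ≤ Σ_a (P({a}) − Q({a}))² / Q({a})`. -/
theorem klDiv_le_chiSq
    {A : Type*} [MeasurableSpace A] [DiscreteMeasurableSpace A] [Countable A]
    (P Q : Measure A) [IsProbabilityMeasure P] [IsProbabilityMeasure Q] :
    (∑' a : A, klTerm (P {a}) (Q {a})) ≤ ∑' a : A, chiSqTerm (P {a}) (Q {a}) := by
  have h_chi : ∑' a, chiSqTerm (P {a}) (Q {a}) =
      ((∑' a, (chiSqTerm (P {a}) (Q {a})).toENNReal : ENNReal) : EReal) := by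
    rw [← EReal.tsum_coe_ennreal]
    simp_rw [EReal.coe_toENNReal (chiSqTerm_nonneg _ _)]
  by_cases h_top : ∑' a, (chiSqTerm (P {a}) (Q {a})).toENNReal = ⊤
  · simp [h_chi, h_top]
  have hPQ (a : A) : Q {a} = 0 → P {a} = 0 :=
    eq_zero_of_chiSqTerm_ne_top fun h => ENNReal.ne_top_of_tsum_ne_top h_top a (by simp [h])
  let p (a : A) : ℝ := (P {a}).toReal
  let q (a : A) : ℝ := (Q {a}).toReal
  have hp (a : A) : 0 ≤ p a := ENNReal.toReal_nonneg
  have hq (a : A) : 0 ≤ q a := ENNReal.toReal_nonneg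
  have hpq (a : A) (h : q a = 0) : p a = 0 := by
    have hQ : Q {a} = 0 := (ENNReal.toReal_eq_zero_iff _).1 h |>.resolve_right (measure_ne_top _ _)
    simp [p, hPQ a hQ]
  have h_sub : HasSum (fun a => p a - q a) 0 := by
    simpa using (hasSum_measure_singleton_toReal P).sub (hasSum_measure_singleton_toReal Q)
  have h_sq : Summable fun a => (p a - q a) ^ 2 / q a := by
    refine (ENNReal.summable_toReal h_top).congr fun a => ?_
    have h_nonneg : 0 ≤ (p a - q a) ^ 2 / q a := div_nonneg (sq_nonneg _) (hq a)
    rw [chiSqTerm_eq_coe (hPQ a), EReal.toENNReal_of_ne_top (EReal.coe_ne_top _),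
      EReal.toReal_coe, ENNReal.toReal_ofReal h_nonneg]
  have h_upper := h_sq.hasSum.add h_sub
  have h_kl : Summable fun a => p a * Real.log (p a / q a) := by
    have h_diff : Summable fun a => p a * Real.log (p a / q a) - (p a - q a) :=
      h_sq.of_nonneg_of_le (fun a => sub_nonneg.2 (sub_le_mul_log_div (hp a) (hq a) (hpq a)))
        fun a => sub_le_iff_le_add.2 (mul_log_div_le_sq_div_add (hp a) (hq a) (hpq a))
    simpa using h_diff.add h_sub.summable
  have h_le := hasSum_le (fun a => mul_log_div_le_sq_div_add (hp a) (hq a) (hpq a))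
    h_kl.hasSum h_upper
  rw [add_zero] at h_le
  simp_rw [fun a => klTerm_eq_coe (hPQ a), fun a => chiSqTerm_eq_coe (hPQ a)]
  rw [(EReal.hasSum_coe h_kl.hasSum).tsum_eq, (EReal.hasSum_coe h_sq.hasSum).tsum_eq]
  exact EReal.coe_le_coe_iff.2 h_le
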